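/- Let G be a finite group with center Z such that G/Z is an elementary abelian p-group of order p^{2e} and for every g ∈ G \ Z the map g' ↦ [g,g'] from G to Z is surjective. Let ψ : Z → ℂ^× be a non-trivial character and let ρ_ψ be the unique irreducible complex representation of G whose restriction to Z contains ψ. Let A ⊂ Aut(G) be a cyclic subgroup of order p^e + 1 such that A acts trivially on Z and such that, for every non-trivial a ∈ A, the induced action of a on G/Z fixes only the identity coset. Then there is a unique (up to isomorphism) irreducible complex representation ρ'_ψ of the semidirect product A ⋉ G such that ρ'_ψ restricted to G is isomorphic to ρ_ψ and the character of ρ'_ψ takes the value −1 at every non-trivial element a of A (viewed inside A ⋉ G). -/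

import Mathlib

open Finset in
lemma aux_fourier {B : Type*} [AddCommGroup B] [Fintype B] (q : ℕ)
    (hB : Fintype.card B = q + 1) (t : B → ℂ) (m : AddChar B ℂ → ℕ)
    (hm : ∀ χ : AddChar B ℂ, ∑ b, χ (-b) * t b = (q + 1 : ℂ) * m χ)
    (h0 : t 0 = q) (ht : ∀ b, b ≠ 0 → t b * t (-b) = 1) :
    ∃ χ : AddChar B ℂ, ∀ b, b ≠ 0 → t b = - χ b := by
  classical
  have hn : (q + 1 : ℂ) ≠ 0 := by exact_mod_cast Nat.succ_ne_zero q
  have hinv : ∀ c, t c = ∑ χ : AddChar B ℂ, χ c * m χ := by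
    intro c
    apply mul_left_cancel₀ hn
    rw [Finset.mul_sum]
    calc (q + 1 : ℂ) * t c = ∑ b, t b * (if c - b = 0 then (Fintype.card B : ℂ) else 0) := by
          simp [sub_eq_zero, hB, mul_comm]
      _ = ∑ b, ∑ χ : AddChar B ℂ, t b * χ (c - b) := by
          refine Finset.sum_congr rfl fun b _ => ?_
          rw [← AddChar.sum_apply_eq_ite, Finset.mul_sum]
      _ = ∑ χ : AddChar B ℂ, χ c * ∑ b, χ (-b) * t b := by
          rw [Finset.sum_comm]
          refine Finset.sum_congr rfl fun χ _ => ?_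
          rw [Finset.mul_sum]
          refine Finset.sum_congr rfl fun b _ => ?_
          rw [sub_eq_add_neg, AddChar.map_add_eq_mul]; ring
      _ = _ := by
          refine Finset.sum_congr rfl fun χ _ => ?_
          rw [hm]; ring
  have hs1 : ∑ χ : AddChar B ℂ, m χ = q := by
    have := hinv 0
    rw [h0] at this
    simp only [AddChar.map_zero_eq_one, one_mul] at this
    exact_mod_cast this.symm
  have hs2 : ∑ χ : AddChar B ℂ, m χ * m χ = q := by
    have : (q + 1 : ℂ) * ∑ χ : AddChar B ℂ, (m χ * m χ : ℂ) = (q + 1) * q := by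
      calc (q + 1 : ℂ) * ∑ χ : AddChar B ℂ, (m χ * m χ : ℂ)
          = ∑ χ : AddChar B ℂ, ∑ b, m χ * (χ (-b) * t b) := by
            rw [Finset.mul_sum]
            refine Finset.sum_congr rfl fun χ _ => ?_
            rw [← Finset.mul_sum, hm]; ring
        _ = ∑ b, t b * t (-b) := by
            rw [Finset.sum_comm]
            refine Finset.sum_congr rfl fun b _ => ?_
            rw [hinv (-b), Finset.mul_sum]
            refine Finset.sum_congr rfl fun χ _ => ?_
            ring
        _ = _ := by
            rw [← Finset.add_sum_erase _ _ (Finset.mem_univ (0 : B)),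
              Finset.sum_congr rfl (g := fun _ => (1 : ℂ))
                (fun b hb => ht b (Finset.ne_of_mem_erase hb))]
            simp [h0, hB, Finset.card_erase_of_mem]
            ring
    have := mul_left_cancel₀ hn this
    exact_mod_cast this
  have hle1 : ∀ χ, m χ ≤ 1 := by
    intro χ
    have h := (Finset.sum_eq_sum_iff_of_le (s := Finset.univ)
      (f := fun χ => m χ) (g := fun χ => m χ * m χ)
      (fun χ _ => Nat.le_mul_self _)).1 (hs1.trans hs2.symm) χ (Finset.mem_univ _)
    by_contra hc
    have : m χ * 1 < m χ * m χ := Nat.mul_lt_mul_of_pos_left (by omega) (by omega)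
    omega
  have hcard : Fintype.card (AddChar B ℂ) = q + 1 := by rw [AddChar.card_eq, hB]
  obtain ⟨χ0, hχ0⟩ : ∃ χ0, m χ0 = 0 := by
    by_contra hc
    push Not at hc
    have : ∀ χ, m χ = 1 := fun χ => by have := hc χ; have := hle1 χ; omega
    simp [this, hcard] at hs1
  have hone : ∀ χ, χ ≠ χ0 → m χ = 1 := by
    intro χ hχ
    refine (Finset.sum_eq_sum_iff_of_le (s := Finset.univ.erase χ0)
      (f := fun χ => m χ) (g := fun _ => 1) (fun χ _ => hle1 χ)).1 ?_ χ (by simp [hχ])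
    rw [← Finset.add_sum_erase _ _ (Finset.mem_univ χ0), hχ0, zero_add] at hs1
    rw [hs1]
    simp [Finset.card_erase_of_mem, hcard]
  refine ⟨χ0, fun b hb => ?_⟩
  have hsum : ∑ χ : AddChar B ℂ, χ b = 0 := AddChar.sum_apply_eq_zero_iff_ne_zero.2 hb
  rw [← Finset.add_sum_erase _ _ (Finset.mem_univ χ0)] at hsum
  rw [hinv b, ← Finset.add_sum_erase _ _ (Finset.mem_univ χ0), hχ0]
  rw [Finset.sum_congr rfl (g := fun χ : AddChar B ℂ => χ b)
    (fun χ hχ => by rw [hone χ (Finset.ne_of_mem_erase hχ)]; simp)]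
  simp only [Nat.cast_zero, mul_zero, zero_add]
  linear_combination hsum

lemma aux_inv {A V : Type*} [Group A] [Fintype A] [AddCommGroup V] [Module ℂ V]
    [FiniteDimensional ℂ V] (σ : Representation ℂ A V) :
    ∑ a, LinearMap.trace ℂ V (σ a) = (Fintype.card A : ℂ) * (Module.finrank ℂ σ.invariants : ℕ) := by
  have hne : (Fintype.card A : ℂ) ≠ 0 := Nat.cast_ne_zero.2 Fintype.card_ne_zero
  letI : Invertible (Fintype.card A : ℂ) := invertibleOfNonzero hne
  rw [← σ.isProj_averageMap.trace]
  simp [GroupAlgebra.average, map_sum, hne]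

/-- Normalisation of the trace by twisting with a character. -/
lemma aux_twist {A V : Type*} [Group A] [IsCyclic A] [Finite A] [AddCommGroup V] [Module ℂ V]
    [FiniteDimensional ℂ V] (σ : Representation ℂ A V) (q : ℕ) (hA : Nat.card A = q + 1)
    (hq : Module.finrank ℂ V = q)
    (ht : ∀ a, a ≠ 1 → LinearMap.trace ℂ V (σ a) * LinearMap.trace ℂ V (σ a⁻¹) = 1) :
    ∃ c : A →* ℂ, ∀ a, a ≠ 1 → c a * LinearMap.trace ℂ V (σ a) = -1 := by
  letI : CommGroup A := IsCyclic.commGroup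
  letI : Fintype A := Fintype.ofFinite A
  have hA' : Fintype.card A = q + 1 := by rw [← Nat.card_eq_fintype_card]; exact hA
  let tw : AddChar (Additive A) ℂ → Representation ℂ A V := fun χ =>
    { toFun := fun a => χ (Additive.ofMul a⁻¹) • σ a
      map_one' := by simp
      map_mul' := fun a b => by
        rw [map_mul, mul_inv, ofMul_mul, AddChar.map_add_eq_mul, smul_mul_smul_comm] }
  obtain ⟨χ, hχ⟩ := aux_fourier (B := Additive A) q (by simpa using hA')
    (fun a => LinearMap.trace ℂ V (σ a.toMul))
    (fun χ => Module.finrank ℂ (tw χ).invariants)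
    (fun χ => by
      have := aux_inv (tw χ)
      rw [hA'] at this
      push_cast at this
      rw [← this]
      refine Fintype.sum_equiv Additive.toMul _ _ fun a => ?_
      simp [tw])
    (by simp [hq])
    (fun b hb => ht _ (by simpa using hb))
  refine ⟨{ toFun := fun a => χ (Additive.ofMul a⁻¹), map_one' := by simp,
            map_mul' := fun a b => by
              rw [mul_inv, ofMul_mul, AddChar.map_add_eq_mul] }, fun a ha => ?_⟩
  have := hχ (Additive.ofMul a) (by simpa using ha)
  simp only [toMul_ofMul] at this
  simp only [MonoidHom.coe_mk, OneHom.coe_mk]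
  rw [this, mul_neg, ← AddChar.map_add_eq_mul, ← ofMul_mul]
  simp

lemma aux_schur {G V : Type*} [Group G] [AddCommGroup V] [Module ℂ V]
    [FiniteDimensional ℂ V] [Nontrivial V] (ρ : Representation ℂ G V)
    (hirr : ∀ U : Submodule ℂ V, (∀ g v, v ∈ U → ρ g v ∈ U) → U = ⊥ ∨ U = ⊤)
    (T : Module.End ℂ V) (hT : ∀ g, T * ρ g = ρ g * T) : ∃ c : ℂ, T = c • 1 := by
  obtain ⟨μ, hμ⟩ := Module.End.exists_eigenvalue T
  refine ⟨μ, ?_⟩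
  rcases hirr (Module.End.eigenspace T μ) (fun g v hv => by
    rw [Module.End.mem_eigenspace_iff] at hv ⊢
    have := LinearMap.congr_fun (hT g) v
    simp only [Module.End.mul_apply] at this
    rw [this, hv, map_smul]) with h | h
  · exact absurd h hμ
  · ext v
    have : v ∈ Module.End.eigenspace T μ := h ▸ Submodule.mem_top
    simpa using Module.End.mem_eigenspace_iff.1 this

lemma aux_central {G V : Type*} [Group G] [AddCommGroup V] [Module ℂ V]
    (ρ : Representation ℂ G V)
    (hirr : ∀ U : Submodule ℂ V, (∀ g v, v ∈ U → ρ g v ∈ U) → U = ⊥ ∨ U = ⊤)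
    (ψ : Subgroup.center G →* ℂˣ)
    (hcont : ∃ v : V, v ≠ 0 ∧ ∀ z : Subgroup.center G, ρ (z : G) v = (ψ z : ℂ) • v)
    (z : Subgroup.center G) : ρ (z : G) = (ψ z : ℂ) • 1 := by
  obtain ⟨v, hv0, hv⟩ := hcont
  rcases hirr (⨅ z : Subgroup.center G, Module.End.eigenspace (ρ (z : G)) (ψ z : ℂ))
    (fun g v hv => by
      simp only [Submodule.mem_iInf, Module.End.mem_eigenspace_iff] at hv ⊢
      intro z
      have : ρ (z : G) (ρ g v) = ρ g (ρ (z : G) v) := by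
        rw [← Module.End.mul_apply, ← Module.End.mul_apply, ← map_mul, ← map_mul,
          Subgroup.mem_center_iff.1 z.2 g]
      rw [this, hv z, map_smul]) with h | h
  · exfalso
    apply hv0
    have : v ∈ (⨅ z : Subgroup.center G, Module.End.eigenspace (ρ (z : G)) (ψ z : ℂ)) := by
      simpa only [Submodule.mem_iInf, Module.End.mem_eigenspace_iff] using hv
    rw [h] at this
    simpa using this
  · ext v
    have : v ∈ (⨅ z : Subgroup.center G, Module.End.eigenspace (ρ (z : G)) (ψ z : ℂ)) :=
      h ▸ Submodule.mem_top
    simp only [Submodule.mem_iInf, Module.End.mem_eigenspace_iff] at this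
    simpa using this z

lemma aux_trace_zero {G V : Type*} [Group G] [AddCommGroup V] [Module ℂ V]
    (ρ : Representation ℂ G V) (ψ : Subgroup.center G →* ℂˣ) (hψ : ψ ≠ 1)
    (hcomm : ∀ g : G, g ∉ Subgroup.center G → ∀ z ∈ Subgroup.center G,
      ∃ g' : G, g * g' * g⁻¹ * g'⁻¹ = z)
    (hc : ∀ z : Subgroup.center G, ρ (z : G) = (ψ z : ℂ) • 1)
    (g : G) (hg : g ∉ Subgroup.center G) : LinearMap.trace ℂ V (ρ g) = 0 := by
  obtain ⟨z, hz⟩ : ∃ z, ψ z ≠ 1 := by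
    by_contra h
    push Not at h
    exact hψ (MonoidHom.ext h)
  obtain ⟨g', hg'⟩ := hcomm g hg z z.2
  have h1 : g = z * (g' * g * g'⁻¹) := by rw [← hg']; group
  have h2 : LinearMap.trace ℂ V (ρ g) = (ψ z : ℂ) * LinearMap.trace ℂ V (ρ g) := by
    conv_lhs => rw [h1]
    rw [map_mul, hc, smul_mul_assoc, one_mul, map_smul, smul_eq_mul, map_mul,
      LinearMap.trace_mul_comm, ← map_mul]
    congr 3
    group
  have hz' : (ψ z : ℂ) - 1 ≠ 0 := by
    rw [sub_ne_zero]
    exact fun h => hz (Units.ext h)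
  have : ((ψ z : ℂ) - 1) * LinearMap.trace ℂ V (ρ g) = 0 := by linear_combination -h2
  exact (mul_eq_zero.1 this).resolve_left hz'

/-- The key sum. -/
lemma aux_sum {G V : Type*} [Group G] [Fintype G] [AddCommGroup V] [Module ℂ V]
    [FiniteDimensional ℂ V]
    (ρ : Representation ℂ G V) (ψ : Subgroup.center G →* ℂˣ)
    (hc : ∀ z : Subgroup.center G, ρ (z : G) = (ψ z : ℂ) • 1)
    (h0 : ∀ g : G, g ∉ Subgroup.center G → LinearMap.trace ℂ V (ρ g) = 0)
    (b : MulAut G) (hb : ∀ z ∈ Subgroup.center G, b z = z) (f : V →ₗ[ℂ] ℂ) (w : V) :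
    ∑ g, f (ρ g⁻¹ w) * LinearMap.trace ℂ V (ρ (b g))
      = (Nat.card (Subgroup.center G) : ℂ) * (Module.finrank ℂ V * f w) := by
  classical
  have key : ∀ g, f (ρ g⁻¹ w) * LinearMap.trace ℂ V (ρ (b g)) =
      if g ∈ Subgroup.center G then (Module.finrank ℂ V * f w : ℂ) else 0 := by
    intro g
    split_ifs with hg
    · have h1 := hc ⟨g, hg⟩
      have h2 := hc (⟨g, hg⟩⁻¹)
      simp only [Subgroup.coe_inv, map_inv] at h1 h2
      rw [hb g hg, h1, h2]
      simp only [LinearMap.smul_apply, Module.End.one_apply, map_smul, LinearMap.trace_one,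
        smul_eq_mul]
      have : ((ψ ⟨g, hg⟩)⁻¹ : ℂˣ) * (ψ ⟨g, hg⟩ : ℂ) = 1 := Units.inv_mul _
      linear_combination (f w * Module.finrank ℂ V) * this
    · rw [h0 (b g), mul_zero]
      intro h
      apply hg
      have := hb _ h
      rw [b.injective this] at h
      exact h
  rw [Finset.sum_congr rfl (fun g _ => key g), Finset.sum_ite, Finset.sum_const_zero, add_zero,
    Finset.sum_const, nsmul_eq_mul, Nat.card_eq_fintype_card, Fintype.card_subtype]

/-- Averaging. -/
lemma aux_average {G V : Type*} [Group G] [Fintype G] [AddCommGroup V] [Module ℂ V]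
    [FiniteDimensional ℂ V] [Nontrivial V] (ρ : Representation ℂ G V)
    (hirr : ∀ U : Submodule ℂ V, (∀ g v, v ∈ U → ρ g v ∈ U) → U = ⊥ ∨ U = ⊤)
    (X : Module.End ℂ V) :
    (Module.finrank ℂ V : ℂ) • ∑ g, ρ g * X * ρ g⁻¹ =
      ((Nat.card G : ℂ) * LinearMap.trace ℂ V X) • (1 : Module.End ℂ V) := by
  obtain ⟨c, hcc⟩ := aux_schur ρ hirr (∑ g, ρ g * X * ρ g⁻¹) (fun h => by
    rw [Finset.sum_mul, Finset.mul_sum]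
    refine Fintype.sum_equiv (Equiv.mulLeft h⁻¹) _ _ fun g => ?_
    simp only [Equiv.coe_mulLeft, mul_inv_rev, inv_inv, map_mul, ← mul_assoc]
    rw [← map_mul, mul_inv_cancel, map_one, one_mul])
  have ht := congrArg (LinearMap.trace ℂ V) hcc
  rw [map_sum, Finset.sum_congr rfl (g := fun _ => LinearMap.trace ℂ V X) (fun g _ => by
    rw [LinearMap.trace_mul_comm, ← mul_assoc, ← map_mul, inv_mul_cancel, map_one, one_mul])] at ht
  simp only [Finset.sum_const, map_smul, LinearMap.trace_one, smul_eq_mul, nsmul_eq_mul,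
    Finset.card_univ] at ht
  rw [hcc, smul_smul, Nat.card_eq_fintype_card, ht, mul_comm]

lemma aux_dim {G V : Type*} [Group G] [Fintype G] [AddCommGroup V] [Module ℂ V]
    [FiniteDimensional ℂ V] [Nontrivial V] (ρ : Representation ℂ G V)
    (hirr : ∀ U : Submodule ℂ V, (∀ g v, v ∈ U → ρ g v ∈ U) → U = ⊥ ∨ U = ⊤)
    (ψ : Subgroup.center G →* ℂˣ)
    (hc : ∀ z : Subgroup.center G, ρ (z : G) = (ψ z : ℂ) • 1)
    (h0 : ∀ g : G, g ∉ Subgroup.center G → LinearMap.trace ℂ V (ρ g) = 0) :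
    Nat.card (Subgroup.center G) * Module.finrank ℂ V ^ 2 = Nat.card G := by
  obtain ⟨w, hw⟩ := exists_ne (0 : V)
  obtain ⟨f, hf⟩ : ∃ f : Module.Dual ℂ V, f w ≠ 0 := by
    by_contra h
    push Not at h
    exact hw ((Module.forall_dual_apply_eq_zero_iff ℂ w).1 h)
  have h1 := aux_sum ρ ψ hc h0 1 (fun _ _ => rfl) f w
  have h2 : (Module.finrank ℂ V : ℂ) • ∑ g, f (ρ g⁻¹ w) • ρ g
      = (Nat.card G : ℂ) • f.smulRight w := by
    ext v
    have := LinearMap.congr_fun (aux_average ρ hirr (f.smulRight v)) w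
    simp only [LinearMap.smul_apply, LinearMap.sum_apply, Module.End.mul_apply,
      LinearMap.smulRight_apply, map_smul, LinearMap.trace_smulRight, Module.End.one_apply] at this ⊢
    rw [this, smul_smul]
  have h3 := congrArg (LinearMap.trace ℂ V) h2
  simp only [map_smul, map_sum, smul_eq_mul, LinearMap.trace_smulRight] at h3
  simp only [MulAut.one_apply] at h1
  rw [h1] at h3
  have h4 : ((Nat.card (Subgroup.center G) * Module.finrank ℂ V ^ 2 : ℕ) : ℂ) = Nat.card G := by
    apply mul_right_cancel₀ hf
    push_cast
    linear_combination h3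
  exact_mod_cast h4

lemma aux_intertwiner {G V : Type*} [Group G] [Fintype G] [AddCommGroup V] [Module ℂ V]
    [FiniteDimensional ℂ V] [Nontrivial V] (ρ : Representation ℂ G V)
    (hirr : ∀ U : Submodule ℂ V, (∀ g v, v ∈ U → ρ g v ∈ U) → U = ⊥ ∨ U = ⊤)
    (ψ : Subgroup.center G →* ℂˣ)
    (hc : ∀ z : Subgroup.center G, ρ (z : G) = (ψ z : ℂ) • 1)
    (h0 : ∀ g : G, g ∉ Subgroup.center G → LinearMap.trace ℂ V (ρ g) = 0)
    (b : MulAut G) (hb : ∀ z ∈ Subgroup.center G, b z = z) :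
    ∃ T : (Module.End ℂ V)ˣ, ∀ g, (T : Module.End ℂ V) * ρ g = ρ (b g) * T := by
  obtain ⟨w, hw⟩ := exists_ne (0 : V)
  obtain ⟨f, hf⟩ : ∃ f : Module.Dual ℂ V, f w ≠ 0 := by
    by_contra h
    push Not at h
    exact hw ((Module.forall_dual_apply_eq_zero_iff ℂ w).1 h)
  have h1 := aux_sum ρ ψ hc h0 b hb f w
  let T : V → Module.End ℂ V := fun v => ∑ g, ρ (b g) * f.smulRight v * ρ g⁻¹
  have hT : ∀ v h, T v * ρ h = ρ (b h) * T v := by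
    intro v h
    simp only [T]
    rw [Finset.sum_mul, Finset.mul_sum]
    refine Fintype.sum_equiv (Equiv.mulLeft h⁻¹) _ _ fun g => ?_
    simp only [Equiv.coe_mulLeft, mul_inv_rev, inv_inv, map_mul, ← mul_assoc]
    rw [← map_mul ρ, ← map_mul b, mul_inv_cancel, map_one, map_one, one_mul]
  obtain ⟨v, hv⟩ : ∃ v, T v ≠ 0 := by
    by_contra h
    push Not at h
    have h2 : ∑ g, f (ρ g⁻¹ w) • ρ (b g) = 0 := by
      ext v
      have := LinearMap.congr_fun (h v) w
      simpa [T, LinearMap.sum_apply] using this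
    have h3 := congrArg (LinearMap.trace ℂ V) h2
    simp only [map_smul, map_sum, smul_eq_mul, map_zero] at h3
    rw [h1] at h3
    have : (Nat.card (Subgroup.center G) : ℂ) ≠ 0 := Nat.cast_ne_zero.2 Nat.card_pos.ne'
    have : (Module.finrank ℂ V : ℂ) ≠ 0 := Nat.cast_ne_zero.2 Module.finrank_pos.ne'
    simp_all
  have hu : IsUnit (T v) := by
    rw [LinearMap.isUnit_iff_ker_eq_bot]
    refine (hirr (LinearMap.ker (T v)) (fun g x hx => ?_)).resolve_right ?_
    · rw [LinearMap.mem_ker] at hx ⊢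
      rw [← Module.End.mul_apply, hT, Module.End.mul_apply, hx, map_zero]
    · intro h
      exact hv (LinearMap.ker_eq_top.1 h)
  exact ⟨hu.unit, fun g => hT v g⟩

lemma aux_trace_one {G V : Type*} [Group G] [Fintype G] [AddCommGroup V] [Module ℂ V]
    [FiniteDimensional ℂ V] [Nontrivial V] (ρ : Representation ℂ G V)
    (hirr : ∀ U : Submodule ℂ V, (∀ g v, v ∈ U → ρ g v ∈ U) → U = ⊥ ∨ U = ⊤)
    (ψ : Subgroup.center G →* ℂˣ)
    (hc : ∀ z : Subgroup.center G, ρ (z : G) = (ψ z : ℂ) • 1)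
    (h0 : ∀ g : G, g ∉ Subgroup.center G → LinearMap.trace ℂ V (ρ g) = 0)
    (b : MulAut G) (hb : ∀ z ∈ Subgroup.center G, b z = z)
    (hfix : ∀ g : G, b g * g⁻¹ ∈ Subgroup.center G → g ∈ Subgroup.center G)
    (T T' : Module.End ℂ V) (hTT : T * T' = 1) (hT : ∀ g, T * ρ g = ρ (b g) * T) :
    LinearMap.trace ℂ V T * LinearMap.trace ℂ V T' = 1 := by
  classical
  have h1 := aux_average ρ hirr T
  have h2 := congrArg (fun X => LinearMap.trace ℂ V (X * T')) h1
  simp only [smul_mul_assoc, map_smul, Finset.sum_mul, map_sum, smul_eq_mul, one_mul] at h2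
  have key : ∀ g, LinearMap.trace ℂ V (ρ g * T * ρ g⁻¹ * T') =
      if g ∈ Subgroup.center G then (Module.finrank ℂ V : ℂ) else 0 := by
    intro g
    have e1 : ρ g * T * ρ g⁻¹ * T' = ρ (g * b g⁻¹) := by
      rw [mul_assoc (ρ g), hT, map_mul, mul_assoc, mul_assoc, hTT, mul_one]
    rw [e1]
    split_ifs with hg
    · rw [hb _ (inv_mem hg), mul_inv_cancel, map_one, LinearMap.trace_one]
    · apply h0
      intro h
      apply hg
      apply hfix
      have := inv_mem h
      simpa using this
  rw [Finset.sum_congr rfl (fun g _ => key g), Finset.sum_ite, Finset.sum_const_zero, add_zero,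
    Finset.sum_const, nsmul_eq_mul, ← Fintype.card_subtype] at h2
  have hd : ((Nat.card (Subgroup.center G) * Module.finrank ℂ V ^ 2 : ℕ) : ℂ) = Nat.card G := by
    rw [aux_dim ρ hirr ψ hc h0]
  have hG : (Nat.card G : ℂ) ≠ 0 := Nat.cast_ne_zero.2 Nat.card_pos.ne'
  apply mul_left_cancel₀ hG
  rw [← mul_assoc, ← h2, mul_one, ← hd, Nat.card_eq_fintype_card]
  push_cast
  have : Fintype.card {x // x ∈ Subgroup.center G} = Fintype.card (Subgroup.center G) := rfl
  ring

lemma aux_exists_rep {G V : Type*} [Group G] [Fintype G] [AddCommGroup V] [Module ℂ V]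
    [FiniteDimensional ℂ V] [Nontrivial V] (ρ : Representation ℂ G V)
    (hirr : ∀ U : Submodule ℂ V, (∀ g v, v ∈ U → ρ g v ∈ U) → U = ⊥ ∨ U = ⊤)
    (A : Subgroup (MulAut G)) (hA : IsCyclic A) (hfin : Finite A)
    (hex : ∀ b : A, ∃ T : (Module.End ℂ V)ˣ, ∀ g,
      (T : Module.End ℂ V) * ρ g = ρ ((b : MulAut G) g) * T) :
    ∃ σ : Representation ℂ A V, ∀ (b : A) g, σ b * ρ g = ρ ((b : MulAut G) g) * σ b := by
  obtain ⟨a, ha⟩ := hA.exists_generator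
  obtain ⟨T, hT⟩ := hex a
  have hpow : ∀ (k : ℕ) g, ((T ^ k : (Module.End ℂ V)ˣ) : Module.End ℂ V) * ρ g
      = ρ (((a ^ k : A) : MulAut G) g) * (T ^ k : (Module.End ℂ V)ˣ) := by
    intro k
    induction k with
    | zero => intro g; simp
    | succ k ih =>
      intro g
      rw [pow_succ T, Units.val_mul, mul_assoc, hT, ← mul_assoc, ih, mul_assoc, pow_succ a]
      rfl
  have hn : orderOf a ≠ 0 := (orderOf_pos a).ne'
  obtain ⟨c, hcc⟩ := aux_schur ρ hirr ((T ^ orderOf a : (Module.End ℂ V)ˣ) : Module.End ℂ V)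
    (fun g => by rw [hpow, pow_orderOf_eq_one]; rfl)
  have hc0 : c ≠ 0 := by
    rintro rfl
    rw [zero_smul] at hcc
    exact (T ^ orderOf a).ne_zero hcc
  obtain ⟨r, hr⟩ := IsAlgClosed.exists_pow_nat_eq c (Nat.pos_of_ne_zero hn)
  have hr0 : r ≠ 0 := by
    rintro rfl
    rw [zero_pow hn] at hr
    exact hc0 hr.symm
  let T1 : (Module.End ℂ V)ˣ := (Units.mk0 r hr0)⁻¹ • T
  have hT1 : (T1 : Module.End ℂ V) = r⁻¹ • (T : Module.End ℂ V) := by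
    simp only [T1, Units.val_smul]
    rfl
  have hT1n : T1 ^ orderOf a = 1 := by
    ext1
    rw [Units.val_pow_eq_pow_val, hT1, smul_pow, ← Units.val_pow_eq_pow_val, hcc, smul_smul,
      inv_pow, hr, inv_mul_cancel₀ hc0, one_smul, Units.val_one]
  let F := monoidHomOfForallMemZpowers ha (orderOf_dvd_of_pow_eq_one hT1n)
  have hF : F a = T1 := monoidHomOfForallMemZpowers_apply_gen ha (orderOf_dvd_of_pow_eq_one hT1n)
  refine ⟨(Units.coeHom _).comp F, fun b g => ?_⟩
  obtain ⟨k, rfl⟩ := (mem_powers_iff_mem_zpowers.2 (ha b) : b ∈ Submonoid.powers a)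
  simp only [MonoidHom.comp_apply, map_pow, hF, Units.coeHom_apply, hT1, smul_pow]
  rw [smul_mul_assoc, mul_smul_comm, ← Units.val_pow_eq_pow_val, hpow]

/-- **Extension of the Heisenberg representation to a semidirect product with a cyclic
group of order `p^e + 1`.**
Let `G` be a finite group with center `Z` such that `G/Z` is elementary abelian of order
`p^(2e)` and commutator maps from non-central elements are surjective onto `Z`.  Let
`ρψ` be the unique irreducible complex representation of `G` whose restriction to `Z`
contains the non-trivial character `ψ`.  Let `A ⊆ Aut G` be cyclic of order `p^e + 1`,
acting trivially on `Z` and fixing only the trivial coset of `G/Z` for non-trivial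
elements.  Then there is, uniquely up to isomorphism, an irreducible representation
`ρ'` of `A ⋉ G` restricting to `ρψ` on `G` with trace `−1` at every non-trivial `a ∈ A`. -/
theorem stmt_1 {p e : ℕ} (hp : p.Prime) (he : 1 ≤ e) (G : Type) [Group G] [Fintype G]
    (habel : ∀ x y : G ⧸ Subgroup.center G, x * y = y * x)
    (helem : ∀ x : G ⧸ Subgroup.center G, x ^ p = 1)
    (hcard : Nat.card (G ⧸ Subgroup.center G) = p ^ (2 * e))
    (hcomm : ∀ g : G, g ∉ Subgroup.center G → ∀ z ∈ Subgroup.center G,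
      ∃ g' : G, g * g' * g⁻¹ * g'⁻¹ = z)
    (ψ : Subgroup.center G →* ℂˣ) (hψ : ψ ≠ 1)
    (V : Type) [AddCommGroup V] [Module ℂ V] [FiniteDimensional ℂ V] [Nontrivial V]
    (ρψ : Representation ℂ G V)
    (hirr : ∀ U : Submodule ℂ V, (∀ g v, v ∈ U → ρψ g v ∈ U) → U = ⊥ ∨ U = ⊤)
    (hcont : ∃ v : V, v ≠ 0 ∧ ∀ z : Subgroup.center G, ρψ (z : G) v = (ψ z : ℂ) • v)
    (A : Subgroup (MulAut G)) (hA : IsCyclic A) (hAcard : Nat.card A = p ^ e + 1)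
    (hAZ : ∀ a : A, ∀ z : G, z ∈ Subgroup.center G → (a : MulAut G) z = z)
    (hAfix : ∀ a : A, a ≠ 1 → ∀ g : G,
      (a : MulAut G) g * g⁻¹ ∈ Subgroup.center G → g ∈ Subgroup.center G) :
    ∃ (W : Type) (_ : AddCommGroup W) (_ : Module ℂ W),
      FiniteDimensional ℂ W ∧ Nontrivial W ∧
      ∃ ρ' : Representation ℂ (SemidirectProduct G A A.subtype) W,
        (∀ U : Submodule ℂ W, (∀ x w, w ∈ U → ρ' x w ∈ U) → U = ⊥ ∨ U = ⊤) ∧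
        (∃ eqv : W ≃ₗ[ℂ] V, ∀ g w,
          eqv (ρ' (SemidirectProduct.inl g) w) = ρψ g (eqv w)) ∧
        (∀ a : A, a ≠ 1 →
          LinearMap.trace ℂ W (ρ' (SemidirectProduct.inr a)) = -1) ∧
        (∀ (W' : Type) (_ : AddCommGroup W') (_ : Module ℂ W'),
          FiniteDimensional ℂ W' → Nontrivial W' →
          ∀ ρ'' : Representation ℂ (SemidirectProduct G A A.subtype) W',
            (∀ U : Submodule ℂ W', (∀ x w, w ∈ U → ρ'' x w ∈ U) → U = ⊥ ∨ U = ⊤) →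
            (∃ eqv : W' ≃ₗ[ℂ] V, ∀ g w,
              eqv (ρ'' (SemidirectProduct.inl g) w) = ρψ g (eqv w)) →
            (∀ a : A, a ≠ 1 →
              LinearMap.trace ℂ W' (ρ'' (SemidirectProduct.inr a)) = -1) →
            ∃ eqv : W' ≃ₗ[ℂ] W, ∀ x w, eqv (ρ'' x w) = ρ' x (eqv w)) := by
  have hc := aux_central ρψ hirr ψ hcont
  have h0 := aux_trace_zero ρψ ψ hψ hcomm hc
  have hfin : Finite A := Nat.finite_of_card_ne_zero (by rw [hAcard]; omega)
  have hdim : Module.finrank ℂ V = p ^ e := by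
    have h1 := aux_dim ρψ hirr ψ hc h0
    rw [Subgroup.card_eq_card_quotient_mul_card_subgroup (Subgroup.center G), hcard,
      mul_comm (p ^ (2 * e)), mul_comm 2 e, pow_mul] at h1
    exact Nat.pow_left_injective (n := 2) (by norm_num)
      (Nat.eq_of_mul_eq_mul_left Nat.card_pos h1)
  obtain ⟨σ, hσ⟩ := aux_exists_rep ρψ hirr A hA hfin
    (fun b => aux_intertwiner ρψ hirr ψ hc h0 b (hAZ b))
  obtain ⟨c, hcσ⟩ := aux_twist σ (p ^ e) hAcard hdim (fun a ha =>
    aux_trace_one ρψ hirr ψ hc h0 a (hAZ a) (hAfix a ha) (σ a) (σ a⁻¹)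
      (by rw [← map_mul, mul_inv_cancel, map_one]) (hσ a))
  have hσ' : ∀ (b : A) g, (c b • σ b) * ρψ g = ρψ ((b : MulAut G) g) * (c b • σ b) := by
    intro b g
    rw [smul_mul_assoc, hσ, mul_smul_comm]
  let ρ' : Representation ℂ (SemidirectProduct G A A.subtype) V :=
    { toFun := fun x => ρψ x.left * (c x.right • σ x.right)
      map_one' := by simp
      map_mul' := fun x y => by
        rw [SemidirectProduct.mul_left, SemidirectProduct.mul_right, map_mul, map_mul, map_mul,
          ← smul_mul_smul_comm, mul_assoc, mul_assoc, ← mul_assoc (c x.right • σ x.right), hσ',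
          mul_assoc]
        rfl }
  have hinl : ∀ g, ρ' (SemidirectProduct.inl g) = ρψ g := fun g => by simp [ρ']
  have hinr : ∀ a, ρ' (SemidirectProduct.inr a) = c a • σ a := fun g => by simp [ρ']
  refine ⟨V, inferInstance, inferInstance, inferInstance, inferInstance, ρ', ?_, ?_, ?_, ?_⟩
  · intro U hU
    exact hirr U fun g v hv => by rw [← hinl]; exact hU _ v hv
  · exact ⟨LinearEquiv.refl ℂ V, fun g w => by simp [hinl]⟩
  · intro a ha
    rw [hinr, map_smul, smul_eq_mul, hcσ a ha]
  · intro W' _ _ _ _ ρ'' _ ⟨eqv, heqv⟩ htr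
    -- transported action of `A`
    have hT : ∀ a : A, eqv.conj (ρ'' (SemidirectProduct.inr a)) = c a • σ a := by
      intro a
      by_cases ha : a = 1
      · subst ha
        ext v
        simp
      set S : Module.End ℂ V := eqv.conj (ρ'' (SemidirectProduct.inr a)) with hS
      have hS1 : ∀ g, S * ρψ g = ρψ ((a : MulAut G) g) * S := by
        intro g
        ext v
        obtain ⟨w, rfl⟩ := eqv.surjective v
        simp only [hS, Module.End.mul_apply, LinearEquiv.conj_apply_apply, ← heqv,
          LinearEquiv.symm_apply_apply]
        congr 1
        rw [← Module.End.mul_apply, ← Module.End.mul_apply, ← map_mul, ← map_mul]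
        congr 2
        have := SemidirectProduct.inl_aut (φ := A.subtype) a g
        rw [Subgroup.coe_subtype] at this
        rw [this]
        simp [mul_assoc]
      have hinvs : σ a * σ a⁻¹ = 1 := by rw [← map_mul, mul_inv_cancel, map_one]
      have hinvs' : σ a⁻¹ * σ a = 1 := by rw [← map_mul, inv_mul_cancel, map_one]
      obtain ⟨d, hd⟩ := aux_schur ρψ hirr (σ a⁻¹ * S) (fun g => by
        rw [mul_assoc, hS1, ← mul_assoc, hσ, mul_assoc]
        simp [← MulAut.mul_apply])
      have hSd : S = d • σ a := by
        have := congrArg (fun X => σ a * X) hd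
        simpa only [← mul_assoc, hinvs, one_mul, mul_smul_comm, mul_one] using this
      have ht1 : LinearMap.trace ℂ V S = -1 := by
        rw [hS, LinearMap.trace_conj', htr a ha]
      rw [hSd, map_smul, smul_eq_mul] at ht1
      have ht2 := hcσ a ha
      have hne : LinearMap.trace ℂ V (σ a) ≠ 0 := by
        intro h
        rw [h, mul_zero] at ht2
        norm_num at ht2
      rw [hSd, mul_right_cancel₀ hne (ht1.trans ht2.symm)]
    refine ⟨eqv, fun x w => ?_⟩
    have h2 : eqv (ρ'' (SemidirectProduct.inr x.right) w) = (c x.right • σ x.right) (eqv w) := by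
      rw [← hT, LinearEquiv.conj_apply_apply, LinearEquiv.symm_apply_apply]
    conv_lhs => rw [← SemidirectProduct.inl_left_mul_inr_right x]
    rw [map_mul, Module.End.mul_apply, heqv, h2]
    rfl
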